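/- Let p be a prime with p ≡ 1 (mod 6) such that [-1,5]* splits Z_p with a splitter set B satisfying 1 ∈ B, and suppose that -2/5 ∈ B and -4/3 ∈ B (fractions computed in the field Z_p). Then the entire subgroup ⟨-2/5, -4/3⟩ of Z_p^* generated by -2/5 and -4/3 is contained in B; that is, (-2/5)^a·(-4/3)^b ∈ B for all non-negative integers a and b. -/

import Mathlib

/-- The subset of `ℤ_p` underlying the subgroup of `(ℤ_p)ˣ` generated by the
units whose values lie in `S`. -/
def genSet (p : ℕ) (S : Set (ZMod p)) : Set (ZMod p) :=
  (fun u : (ZMod p)ˣ => (u : ZMod p)) ''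
    ((Subgroup.closure ((fun u : (ZMod p)ˣ => (u : ZMod p)) ⁻¹' S) :
      Subgroup (ZMod p)ˣ) : Set (ZMod p)ˣ)

/-- `M` splits `ℤ_p` with splitter set `B`: every nonzero element of `ℤ_p` has
a unique representation `m * b` with `m ∈ M`, `b ∈ B`, while `0` has no such
representation. -/
def SplitsWith (M : Set ℤ) (p : ℕ) (B : Set (ZMod p)) : Prop :=
  (∀ g : ZMod p, g ≠ 0 → ∃! mb : ℤ × ZMod p,
    mb.1 ∈ M ∧ mb.2 ∈ B ∧ (mb.1 : ZMod p) * mb.2 = g) ∧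
  ¬ ∃ m ∈ M, ∃ b ∈ B, (m : ZMod p) * b = 0

namespace SplitsWith

variable {M : Set ℤ} {p : ℕ} {B : Set (ZMod p)}

theorem mul_ne_zero (h : SplitsWith M p B) {m : ℤ} {x : ZMod p} (hm : m ∈ M) (hx : x ∈ B) :
    (m : ZMod p) * x ≠ 0 :=
  fun h0 => h.2 ⟨m, hm, x, hx, h0⟩

theorem eq_of_mul_eq_mul (h : SplitsWith M p B) {m n : ℤ} {x y : ZMod p} (hm : m ∈ M)
    (hn : n ∈ M) (hx : x ∈ B) (hy : y ∈ B) (hxy : (m : ZMod p) * x = n * y) : m = n :=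
  congrArg Prod.fst ((h.1 _ (h.mul_ne_zero hn hy)).unique
    (y₁ := (m, x)) (y₂ := (n, y)) ⟨hm, hx, hxy⟩ ⟨hn, hy, rfl⟩)

theorem exists_mul_eq (h : SplitsWith M p B) {g : ZMod p} (hg : g ≠ 0) :
    ∃ m ∈ M, ∃ x ∈ B, (m : ZMod p) * x = g := by
  obtain ⟨⟨m, x⟩, ⟨hm, hx, hmx⟩, -⟩ := h.1 g hg
  exact ⟨m, hm, x, hx, hmx⟩

end SplitsWith

section NegOneToFive

variable {p : ℕ} [Fact p.Prime] {B : Set (ZMod p)}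

theorem two_three_five_ne_zero (hB : SplitsWith ({-1, 1, 2, 3, 4, 5} : Set ℤ) p B)
    (h1B : (1 : ZMod p) ∈ B) :
    (2 : ZMod p) ≠ 0 ∧ (3 : ZMod p) ≠ 0 ∧ (5 : ZMod p) ≠ 0 := by
  refine ⟨?_, ?_, ?_⟩
  · simpa using hB.mul_ne_zero (m := 2) (by simp) h1B
  · simpa using hB.mul_ne_zero (m := 3) (by simp) h1B
  · simpa using hB.mul_ne_zero (m := 5) (by simp) h1B

/-- How `-2 * x` can be covered when `x` is in the splitter set. -/
theorem neg_two_div_mul_mem (hB : SplitsWith ({-1, 1, 2, 3, 4, 5} : Set ℤ) p B)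
    (h1B : (1 : ZMod p) ∈ B) {x : ZMod p} (hx : x ∈ B) :
    (-2 : ZMod p) / 5 * x ∈ B ∨ (-2 : ZMod p) / 3 * x ∈ B := by
  obtain ⟨h2, h3, h5⟩ := two_three_five_ne_zero hB h1B
  have hx0 : x ≠ 0 := by simpa using hB.mul_ne_zero (m := 1) (by simp) hx
  obtain ⟨m, hm, y, hy, hmy⟩ := hB.exists_mul_eq (g := -2 * x) (by simp [h2, hx0])
  simp only [Set.mem_insert_iff, Set.mem_singleton_iff] at hm
  rcases hm with rfl | rfl | rfl | rfl | rfl | rfl <;> push_cast at hmy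
  · have := hB.eq_of_mul_eq_mul (m := 1) (n := 2) (by simp) (by simp) hy hx
      (by push_cast; linear_combination -hmy)
    omega
  · have := hB.eq_of_mul_eq_mul (m := -1) (n := 2) (by simp) (by simp) hy hx
      (by push_cast; linear_combination -hmy)
    omega
  · have := hB.eq_of_mul_eq_mul (m := -1) (n := 1) (by simp) (by simp) hy hx
      (mul_left_cancel₀ h2 (by push_cast; linear_combination -hmy))
    omega
  · right
    convert hy using 1
    field_simp
    linear_combination -hmy
  · have := hB.eq_of_mul_eq_mul (m := 2) (n := -1) (by simp) (by simp) hy hx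
      (mul_left_cancel₀ h2 (by push_cast; linear_combination hmy))
    omega
  · left
    convert hy using 1
    field_simp
    linear_combination -hmy

/-- How `-4 * x` can be covered when `x` is in the splitter set. -/
theorem neg_four_div_mul_mem (hB : SplitsWith ({-1, 1, 2, 3, 4, 5} : Set ℤ) p B)
    (h1B : (1 : ZMod p) ∈ B) {x : ZMod p} (hx : x ∈ B) :
    (-4 : ZMod p) / 3 * x ∈ B ∨ (-4 : ZMod p) / 5 * x ∈ B := by
  obtain ⟨h2, h3, h5⟩ := two_three_five_ne_zero hB h1B
  have h4 : (4 : ZMod p) ≠ 0 := by simpa using hB.mul_ne_zero (m := 4) (by simp) h1B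
  have hx0 : x ≠ 0 := by simpa using hB.mul_ne_zero (m := 1) (by simp) hx
  obtain ⟨m, hm, y, hy, hmy⟩ := hB.exists_mul_eq (g := -4 * x) (by simp [h4, hx0])
  simp only [Set.mem_insert_iff, Set.mem_singleton_iff] at hm
  rcases hm with rfl | rfl | rfl | rfl | rfl | rfl <;> push_cast at hmy
  · have := hB.eq_of_mul_eq_mul (m := 1) (n := 4) (by simp) (by simp) hy hx
      (by push_cast; linear_combination -hmy)
    omega
  · have := hB.eq_of_mul_eq_mul (m := -1) (n := 4) (by simp) (by simp) hy hx
      (by push_cast; linear_combination -hmy)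
    omega
  · have := hB.eq_of_mul_eq_mul (m := -1) (n := 2) (by simp) (by simp) hy hx
      (mul_left_cancel₀ h2 (by push_cast; linear_combination -hmy))
    omega
  · left
    convert hy using 1
    field_simp
    linear_combination -hmy
  · have := hB.eq_of_mul_eq_mul (m := -1) (n := 1) (by simp) (by simp) hy hx
      (mul_left_cancel₀ h4 (by push_cast; linear_combination -hmy))
    omega
  · right
    convert hy using 1
    field_simp
    linear_combination -hmy

theorem mul_mem_or_mul_mem (hB : SplitsWith ({-1, 1, 2, 3, 4, 5} : Set ℤ) p B)
    (h1B : (1 : ZMod p) ∈ B) {x : ZMod p} (hx : x ∈ B) :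
    ((-2 : ZMod p) / 5 * x ∈ B ∧ (-4 : ZMod p) / 3 * x ∈ B) ∨
      ((-2 : ZMod p) / 3 * x ∈ B ∧ (-4 : ZMod p) / 5 * x ∈ B) := by
  have double {y z : ZMod p} (hy : y ∈ B) (hz : z ∈ B) (hyz : z = 2 * y) : False := by
    have := hB.eq_of_mul_eq_mul (m := 1) (n := 2) (by simp) (by simp) hz hy (by simpa using hyz)
    omega
  rcases neg_two_div_mul_mem hB h1B hx with h | h <;>
    rcases neg_four_div_mul_mem hB h1B hx with h' | h'
  · exact .inl ⟨h, h'⟩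
  · exact (double h h' (by ring)).elim
  · exact (double h h' (by ring)).elim
  · exact .inr ⟨h, h'⟩

/-- The elements `x` of `B` for which `-2 / 5 * x` and `-4 / 3 * x` are in `B` as well. -/
def cornerSet (B : Set (ZMod p)) : Set (ZMod p) :=
  {x | x ∈ B ∧ (-2 : ZMod p) / 5 * x ∈ B ∧ (-4 : ZMod p) / 3 * x ∈ B}

theorem neg_two_div_five_mul_mem_cornerSet
    (hB : SplitsWith ({-1, 1, 2, 3, 4, 5} : Set ℤ) p B) (h1B : (1 : ZMod p) ∈ B)
    {x : ZMod p} (hx : x ∈ cornerSet B) : (-2 : ZMod p) / 5 * x ∈ cornerSet B := by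
  obtain ⟨h2, h3, h5⟩ := two_three_five_ne_zero hB h1B
  obtain ⟨-, ha, hb⟩ := hx
  refine ⟨ha, (mul_mem_or_mul_mem hB h1B ha).resolve_right fun h => ?_⟩
  have := hB.eq_of_mul_eq_mul (m := 5) (n := -1) (by simp) (by simp) h.1 hb
    (by push_cast; field_simp; ring)
  omega

theorem neg_four_div_three_mul_mem_cornerSet
    (hB : SplitsWith ({-1, 1, 2, 3, 4, 5} : Set ℤ) p B) (h1B : (1 : ZMod p) ∈ B)
    {x : ZMod p} (hx : x ∈ cornerSet B) : (-4 : ZMod p) / 3 * x ∈ cornerSet B := by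
  obtain ⟨-, -, hab⟩ := neg_two_div_five_mul_mem_cornerSet hB h1B hx
  obtain ⟨-, -, hb⟩ := hx
  refine ⟨hb, (mul_mem_or_mul_mem hB h1B hb).resolve_right fun h => ?_⟩
  have := hB.eq_of_mul_eq_mul (m := 1) (n := 2) (by simp) (by simp) h.2 hab
    (by push_cast; ring)
  omega

end NegOneToFive

/-- In a finite group, a set stable under the action of generators is stable under
the subgroup they generate. -/
theorem smul_mem_of_mem_closure {G α : Type*} [Group G] [Finite G] [MulAction G α] {S : Set G}
    {T : Set α} (hS : ∀ u ∈ S, ∀ x ∈ T, u • x ∈ T) {u : G} (hu : u ∈ Subgroup.closure S) :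
    ∀ x ∈ T, u • x ∈ T := by
  rw [← Subgroup.mem_toSubmonoid, Subgroup.closure_toSubmonoid_of_finite] at hu
  induction hu using Submonoid.closure_induction with
  | mem u hu => exact hS u hu
  | one => simp
  | mul u v _ _ hu hv => exact fun x hx => by simpa [mul_smul] using hu _ (hv x hx)

/-- If `p ≡ 1 (mod 6)`, `[-1,5]*` splits `ℤ_p` with splitter set `B ∋ 1`, and
`-2/5, -4/3 ∈ B`, then the whole subgroup `⟨-2/5, -4/3⟩` is contained in `B`;
that is, `(-2/5)^a (-4/3)^b ∈ B` for all `a, b ≥ 0`. -/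
theorem subgroup_subset_splitter (p : ℕ) [hp : Fact p.Prime] (hmod : p % 6 = 1)
    (B : Set (ZMod p))
    (hB : SplitsWith ({-1, 1, 2, 3, 4, 5} : Set ℤ) p B)
    (h1B : (1 : ZMod p) ∈ B)
    (h25 : ((-2 : ZMod p) / 5) ∈ B) (h43 : ((-4 : ZMod p) / 3) ∈ B) :
    genSet p {((-2 : ZMod p) / 5), ((-4 : ZMod p) / 3)} ⊆ B ∧
    ∀ a b : ℕ, ((-2 : ZMod p) / 5) ^ a * ((-4 : ZMod p) / 3) ^ b ∈ B := by
  have h1 : (1 : ZMod p) ∈ cornerSet B := ⟨h1B, by simpa using h25, by simpa using h43⟩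
  have ha {x : ZMod p} := neg_two_div_five_mul_mem_cornerSet (x := x) hB h1B
  have hb {x : ZMod p} := neg_four_div_three_mul_mem_cornerSet (x := x) hB h1B
  constructor
  · rintro _ ⟨u, hu, rfl⟩
    have key := smul_mem_of_mem_closure (T := cornerSet B) (fun v hv x hx => ?_) hu 1 h1
    · simpa [Units.smul_def] using key.1
    · rw [Units.smul_def, smul_eq_mul]
      rcases hv with (hv : (v : ZMod p) = _) | (hv : (v : ZMod p) = _)
      · exact hv ▸ ha hx
      · exact hv ▸ hb hx
  · intro a b
    suffices ((-2 : ZMod p) / 5) ^ a * ((-4 : ZMod p) / 3) ^ b ∈ cornerSet B from this.1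
    induction a with
    | zero =>
      induction b with
      | zero => simpa using h1
      | succ b ih => simpa [pow_succ', mul_assoc] using hb ih
    | succ a ih => rw [pow_succ', mul_assoc]; exact ha ih
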